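/- (Identification equation of the IVQR model.) Let (Ω, P) be a probability space, d, k ≥ 1, U : Ω → ℝ a random variable whose law is the uniform distribution on (0,1) and which takes values in (0,1), X : Ω → ℝ^d a random vector, Z : Ω → ℝ^k a random vector independent of U, and β : (0,1) → ℝ^d a function such that for every ω ∈ Ω the map u ↦ ⟨X(ω), β(u)⟩ is strictly increasing on (0,1). Define Y(ω) = ⟨X(ω), β(U(ω))⟩. Then for every τ ∈ (0,1) and every Borel set B ⊆ ℝ^k with P(Z ∈ B) > 0, the conditional probability P(Y ≤ ⟨X, β(τ)⟩ | Z ∈ B) equals τ. -/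

import Mathlib

open MeasureTheory ProbabilityTheory Real Set

/-- Identification equation of the IVQR model: in the random coefficient model
`Y = ⟨X, β(U)⟩` with `U` uniform on `(0,1)`, `Z` independent of `U`, and
`u ↦ ⟨X(ω), β(u)⟩` strictly increasing on `(0,1)`, for every `τ ∈ (0,1)` and every
Borel set `B` with `P(Z ∈ B) > 0`, `P(Y ≤ ⟨X, β(τ)⟩ | Z ∈ B) = τ`. -/
theorem stmt_10 {Ω : Type*} [MeasurableSpace Ω] (P : Measure Ω) [IsProbabilityMeasure P]
    (d k : ℕ) (hd : 1 ≤ d) (hk : 1 ≤ k)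
    (U : Ω → ℝ) (hU : Measurable U)
    (hUlaw : P.map U = volume.restrict (Set.Ioo (0 : ℝ) 1))
    (hUval : ∀ ω, U ω ∈ Set.Ioo (0 : ℝ) 1)
    (X : Ω → EuclideanSpace ℝ (Fin d))
    (Z : Ω → EuclideanSpace ℝ (Fin k)) (hZ : Measurable Z)
    (hindep : ProbabilityTheory.IndepFun Z U P)
    (β : ℝ → EuclideanSpace ℝ (Fin d))
    (hmono : ∀ ω, StrictMonoOn (fun u => (inner ℝ (X ω) (β u) : ℝ)) (Set.Ioo (0 : ℝ) 1))
    (Y : Ω → ℝ) (hY : ∀ ω, Y ω = (inner ℝ (X ω) (β (U ω)) : ℝ)) :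
    ∀ τ ∈ Set.Ioo (0 : ℝ) 1,
      ∀ B : Set (EuclideanSpace ℝ (Fin k)), MeasurableSet B → 0 < P (Z ⁻¹' B) →
        P ({ω | Y ω ≤ (inner ℝ (X ω) (β τ) : ℝ)} ∩ Z ⁻¹' B) / P (Z ⁻¹' B)
          = ENNReal.ofReal τ := by
  intro τ hτ B hB hpos
  have hevent : {ω | Y ω ≤ (inner ℝ (X ω) (β τ) : ℝ)} = U ⁻¹' Set.Iic τ := by
    ext ω
    simpa [hY] using (hmono ω).le_iff_le (hUval ω) hτ
  have hcdf : P (U ⁻¹' Set.Iic τ) = ENNReal.ofReal τ := by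
    have hinter : Set.Iic τ ∩ Set.Ioo (0 : ℝ) 1 = Set.Ioc 0 τ := by
      ext x
      simp only [Set.mem_inter_iff, Set.mem_Iic, Set.mem_Ioo, Set.mem_Ioc]
      exact ⟨fun h => ⟨h.2.1, h.1⟩, fun h => ⟨h.2, h.1, h.2.trans_lt hτ.2⟩⟩
    rw [← Measure.map_apply hU measurableSet_Iic, hUlaw,
      Measure.restrict_apply measurableSet_Iic, hinter, Real.volume_Ioc, sub_zero]
  rw [hevent, Set.inter_comm, hindep.measure_inter_preimage_eq_mul _ _ hB measurableSet_Iic,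
    hcdf, mul_comm, ENNReal.mul_div_cancel_right hpos.ne' (measure_ne_top P _)]
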